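/- There exists L₁ > 0 such that for every fixed L ≥ L₁ there exists δ₀ > 0 with the following property. Let u : [0,3L] × ℝ → ℝ^k be C² and 2π-periodic in θ, solving Δu + A_t ∂_t u + A_θ ∂_θ u + B u = h with continuous k×k-matrix-valued coefficients satisfying sup|A_t| ≤ δ₀, sup|A_θ| ≤ δ₀, sup|B| ≤ δ₀, and with (∫_{[0,3L]×[0,2π]} |h|² dt dθ)^{1/2} ≤ δ₀ · max_{1≤i≤3} ‖u‖₁,ᵢ. If in addition |∫_0^{2π} u(L,θ) dθ| ≤ δ₀ · max_{1≤i≤3} ‖u‖₁,ᵢ and |∫_0^{2π} u(2L,θ) dθ| ≤ δ₀ · max_{1≤i≤3} ‖u‖₁,ᵢ, then either ‖u‖₁,₂ ≤ e^{-L/2} ‖u‖₁,₁ or ‖u‖₁,₂ ≤ e^{-L/2} ‖u‖₁,₃. -/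

import Mathlib

open Real MeasureTheory

variable {E : Type*} [NormedAddCommGroup E] [NormedSpace ℝ E]

/-- Partial derivative `∂_t u`. -/
noncomputable def pt (u : ℝ × ℝ → E) (p : ℝ × ℝ) : E := fderiv ℝ u p (1, 0)

/-- Partial derivative `∂_θ u`. -/
noncomputable def pθ (u : ℝ × ℝ → E) (p : ℝ × ℝ) : E := fderiv ℝ u p (0, 1)

/-- Flat cylinder Laplacian `Δu = ∂²u/∂t² + ∂²u/∂θ²` (componentwise). -/
noncomputable def cylLap (u : ℝ × ℝ → E) (p : ℝ × ℝ) : E := pt (pt u) p + pθ (pθ u) p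

/-- Squared `W^{1,2}`-norm of `u` over the cylinder piece `[(i-1)L, iL] × [0, 2π]`. -/
noncomputable def normOneSq (L : ℝ) (i : ℕ) (u : ℝ × ℝ → E) : ℝ :=
  ∫ t in (((i : ℝ) - 1) * L)..((i : ℝ) * L), ∫ θ in (0 : ℝ)..(2 * π),
    ‖u (t, θ)‖ ^ 2 + ‖pt u (t, θ)‖ ^ 2 + ‖pθ u (t, θ)‖ ^ 2

/-- The `W^{1,2}`-norm `‖u‖₁,ᵢ`. -/
noncomputable def normOne (L : ℝ) (i : ℕ) (u : ℝ × ℝ → E) : ℝ :=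
  Real.sqrt (normOneSq L i u)

/-- Wirtinger's inequality for complex-valued functions, without the mean-zero normalization. -/
theorem wirtinger_complex {f f' : ℝ → ℂ} (hf : ∀ x, HasDerivAt f (f' x) x) (hf' : Continuous f')
    (hper : f (2 * π) = f 0) :
    ∫ x in (0 : ℝ)..(2 * π), ‖f x‖ ^ 2 ≤
      (∫ x in (0 : ℝ)..(2 * π), ‖f' x‖ ^ 2) + ‖∫ x in (0 : ℝ)..(2 * π), f x‖ ^ 2 := by
  have hab : (0 : ℝ) < 2 * π := by positivity
  have hfc : Continuous f := continuous_iff_continuousAt.2 fun x => (hf x).continuousAt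
  have mem {g : ℝ → ℂ} (hg : Continuous g) :
      MemLp g 2 (volume.restrict (Set.Ioc 0 (2 * π))) :=
    (memLp_two_iff_integrable_sq_norm hg.aestronglyMeasurable).2 (hg.norm.pow 2).integrableOn_Ioc
  have h1 := hasSum_sq_fourierCoeffOn hab (mem hfc)
  have h2 := hasSum_sq_fourierCoeffOn hab (mem hf')
  have h3 := h2.add (hasSum_ite_eq (0 : ℤ) (‖fourierCoeffOn hab f 0‖ ^ 2))
  have hle := hasSum_le (fun n => ?_) h1 h3
  · have h0 : ‖fourierCoeffOn hab f 0‖ = (2 * π)⁻¹ * ‖∫ x in (0 : ℝ)..(2 * π), f x‖ := by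
      rw [fourierCoeffOn_eq_integral]
      simp [abs_of_pos pi_pos]
    rw [h0] at hle
    simp only [sub_zero, smul_eq_mul] at hle
    have h4 : (2 * π)⁻¹ ≤ 1 := inv_le_one_of_one_le₀ (by linarith [pi_gt_three])
    have h5 : 0 < (2 * π)⁻¹ := by positivity
    refine le_of_mul_le_mul_left (hle.trans ?_) h5
    nlinarith [sq_nonneg ‖∫ x in (0 : ℝ)..(2 * π), f x‖,
      mul_nonneg (sub_nonneg.2 h4) (mul_nonneg h5.le (sq_nonneg ‖∫ x in (0 : ℝ)..(2 * π), f x‖))]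
  · by_cases hn : n = 0
    · subst hn
      simp
    · rw [if_neg hn, add_zero, fourierCoeffOn_of_hasDerivAt hab hn (fun x _ => hf x)
        (hf'.intervalIntegrable _ _), hper]
      have hn1 : (1 : ℝ) ≤ |(n : ℝ)| := by exact_mod_cast Int.one_le_abs hn
      have : ‖(1 / (-2 * π * Complex.I * n) * (fourier (-n) ((0 : ℝ) : AddCircle (2 * π - 0)) *
          (f 0 - f 0) - ((2 * π : ℝ) - (0 : ℝ)) * fourierCoeffOn hab f' n) : ℂ)‖ =
          |(n : ℝ)|⁻¹ * ‖fourierCoeffOn hab f' n‖ := by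
        simp [abs_of_pos pi_pos]
        field_simp
      rw [this]
      gcongr
      exact mul_le_of_le_one_left (norm_nonneg _) (inv_le_one_of_one_le₀ hn1)

theorem wirtinger_euclidean {k : ℕ} {f f' : ℝ → EuclideanSpace ℝ (Fin k)}
    (hf : ∀ x, HasDerivAt f (f' x) x) (hf' : Continuous f') (hper : f (2 * π) = f 0) :
    ∫ x in (0 : ℝ)..(2 * π), ‖f x‖ ^ 2 ≤
      (∫ x in (0 : ℝ)..(2 * π), ‖f' x‖ ^ 2) + ‖∫ x in (0 : ℝ)..(2 * π), f x‖ ^ 2 := by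
  have hfc : Continuous f := continuous_iff_continuousAt.2 fun x => (hf x).continuousAt
  have hco (i : Fin k) (x : ℝ) : HasDerivAt (fun y => f y i) (f' x i) x :=
    (EuclideanSpace.proj i : EuclideanSpace ℝ (Fin k) →L[ℝ] ℝ).hasFDerivAt.comp_hasDerivAt x (hf x)
  have hint (i : Fin k) :
      (∫ x in (0 : ℝ)..(2 * π), f x) i = ∫ x in (0 : ℝ)..(2 * π), f x i :=
    ((EuclideanSpace.proj i : EuclideanSpace ℝ (Fin k) →L[ℝ] ℝ).intervalIntegral_comp_comm
      (hfc.intervalIntegrable _ _)).symm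
  have key (i : Fin k) : ∫ x in (0 : ℝ)..(2 * π), ‖f x i‖ ^ 2 ≤
      (∫ x in (0 : ℝ)..(2 * π), ‖f' x i‖ ^ 2) + ‖∫ x in (0 : ℝ)..(2 * π), f x i‖ ^ 2 := by
    have := wirtinger_complex (f := fun x => (f x i : ℂ)) (f' := fun x => (f' x i : ℂ))
      (fun x => (hco i x).ofReal_comp) (by fun_prop) (by simp [hper])
    simpa only [Complex.norm_real, intervalIntegral.integral_ofReal] using this
  simp only [EuclideanSpace.norm_sq_eq, hint]
  rw [intervalIntegral.integral_finsetSum, intervalIntegral.integral_finsetSum,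
    ← Finset.sum_add_distrib]
  · exact Finset.sum_le_sum fun i _ => key i
  · exact fun i _ => Continuous.intervalIntegrable (by fun_prop) _ _
  · exact fun i _ => Continuous.intervalIntegrable (by fun_prop) _ _

/-- Integral over the cylinder piece `[s, t] × [0, 2π]`. -/
noncomputable def cylInt (s t : ℝ) (g : ℝ × ℝ → E) : E :=
  ∫ r in s..t, ∫ θ in (0 : ℝ)..(2 * π), g (r, θ)

theorem continuous_circleInt {g : ℝ × ℝ → E} (hg : Continuous g) :
    Continuous fun r => ∫ θ in (0 : ℝ)..(2 * π), g (r, θ) :=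
  intervalIntegral.continuous_parametric_intervalIntegral_of_continuous'
    (f := fun r θ => g (r, θ)) hg _ _

theorem continuous_slice {X : Type*} [TopologicalSpace X] {g : ℝ × ℝ → X} (hg : Continuous g) (r : ℝ) :
    Continuous fun θ => g (r, θ) := by fun_prop

theorem cylInt_add {s t : ℝ} {f g : ℝ × ℝ → E} (hf : Continuous f) (hg : Continuous g) :
    cylInt s t (fun p => f p + g p) = cylInt s t f + cylInt s t g := by
  unfold cylInt
  rw [← intervalIntegral.integral_add ((continuous_circleInt hf).intervalIntegrable _ _)
    ((continuous_circleInt hg).intervalIntegrable _ _)]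
  congr 1 with r
  exact intervalIntegral.integral_add ((continuous_slice hf r).intervalIntegrable _ _)
    ((continuous_slice hg r).intervalIntegrable _ _)

theorem cylInt_const_mul {s t : ℝ} (c : ℝ) (f : ℝ × ℝ → ℝ) :
    cylInt s t (fun p => c * f p) = c * cylInt s t f := by
  simp [cylInt]

theorem cylInt_mono {s t : ℝ} (hst : s ≤ t) {f g : ℝ × ℝ → ℝ} (hf : Continuous f)
    (hg : Continuous g) (h : ∀ r ∈ Set.Ioo s t, ∀ θ, f (r, θ) ≤ g (r, θ)) :
    cylInt s t f ≤ cylInt s t g := by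
  refine intervalIntegral.integral_mono_on_of_le_Ioo hst
    ((continuous_circleInt hf).intervalIntegrable _ _)
    ((continuous_circleInt hg).intervalIntegrable _ _) fun r hr => ?_
  exact intervalIntegral.integral_mono (by positivity)
    ((continuous_slice hf r).intervalIntegrable _ _)
    ((continuous_slice hg r).intervalIntegrable _ _) fun θ => h r hr θ

theorem cylInt_nonneg {s t : ℝ} (hst : s ≤ t) {f : ℝ × ℝ → ℝ} (h : ∀ p, 0 ≤ f p) :
    0 ≤ cylInt s t f :=
  intervalIntegral.integral_nonneg hst fun _ _ =>
    intervalIntegral.integral_nonneg (by positivity) fun _ _ => h _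

theorem cylInt_add_adjacent {r s t : ℝ} {f : ℝ × ℝ → E} (hf : Continuous f) :
    cylInt r s f + cylInt s t f = cylInt r t f :=
  intervalIntegral.integral_add_adjacent_intervals
    ((continuous_circleInt hf).intervalIntegrable _ _)
    ((continuous_circleInt hf).intervalIntegrable _ _)

theorem cylInt_swap {s t : ℝ} {f : ℝ × ℝ → E} (hf : Continuous f) :
    cylInt s t f = ∫ θ in (0 : ℝ)..(2 * π), ∫ r in s..t, f (r, θ) :=
  intervalIntegral_intervalIntegral_swap (F := fun r θ => f (r, θ))
    ((hf.continuousOn.integrableOn_compact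
      (isCompact_uIcc.prod isCompact_uIcc)).mono_set
      (Set.prod_mono Set.uIoc_subset_uIcc Set.uIoc_subset_uIcc))

/-- Fundamental theorem of calculus in the axial direction, integrated over the circle. -/
theorem circleInt_sub_circleInt [CompleteSpace E] {T s t : ℝ} {g g' : ℝ × ℝ → E}
    (hg : Continuous g) (hg' : Continuous g')
    (hd : ∀ r ∈ Set.Ioo 0 T, ∀ θ, HasDerivAt (fun r => g (r, θ)) (g' (r, θ)) r)
    (hs : s ∈ Set.Icc 0 T) (ht : t ∈ Set.Icc 0 T) :
    (∫ θ in (0 : ℝ)..(2 * π), g (t, θ)) - ∫ θ in (0 : ℝ)..(2 * π), g (s, θ) =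
      cylInt s t g' := by
  rw [cylInt_swap hg', ← intervalIntegral.integral_sub
    ((continuous_slice hg t).intervalIntegrable _ _)
    ((continuous_slice hg s).intervalIntegrable _ _)]
  congr 1 with θ
  refine (intervalIntegral.integral_eq_sub_of_hasDeriv_right
    (f := fun r => g (r, θ)) (by fun_prop) (fun r hr => ?_)
    (Continuous.intervalIntegrable (by fun_prop) _ _)).symm
  refine (hd r ⟨lt_of_le_of_lt ?_ hr.1, lt_of_lt_of_le hr.2 ?_⟩ θ).hasDerivWithinAt
  · exact le_min hs.1 ht.1
  · exact max_le hs.2 ht.2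

/-- The continuous functions `a, b, aa, bb` are the derivatives `u_t, u_θ, u_tt, u_θθ` of the
`2π`-periodic function `u`; the axial ones only inside `(0, T)`. -/
structure IsCylJet {F : Type*} [NormedAddCommGroup F] [NormedSpace ℝ F] (T : ℝ)
    (u a b aa bb : ℝ × ℝ → F) : Prop where
  cont : Continuous u
  cont_t : Continuous a
  cont_θ : Continuous b
  cont_tt : Continuous aa
  cont_θθ : Continuous bb
  deriv_t : ∀ t ∈ Set.Ioo 0 T, ∀ θ, HasDerivAt (fun t => u (t, θ)) (a (t, θ)) t
  deriv_tt : ∀ t ∈ Set.Ioo 0 T, ∀ θ, HasDerivAt (fun t => a (t, θ)) (aa (t, θ)) t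
  deriv_θ : ∀ t θ, HasDerivAt (fun θ => u (t, θ)) (b (t, θ)) θ
  deriv_θθ : ∀ t θ, HasDerivAt (fun θ => b (t, θ)) (bb (t, θ)) θ
  periodic : ∀ t θ, u (t, θ + 2 * π) = u (t, θ)

namespace IsCylJet

section Inner

variable {F : Type*} [NormedAddCommGroup F] [InnerProductSpace ℝ F]
  {T : ℝ} {u a b aa bb : ℝ × ℝ → F}

theorem periodic_θ (J : IsCylJet T u a b aa bb) (t θ : ℝ) :
    b (t, θ + 2 * π) = b (t, θ) := by
  have h1 : HasDerivAt (fun θ => u (t, θ + 2 * π)) (b (t, θ + 2 * π)) θ :=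
    (J.deriv_θ t (θ + 2 * π)).comp_add_const θ (2 * π)
  simp only [J.periodic] at h1
  exact h1.unique (J.deriv_θ t θ)

theorem circleInt_θθ [CompleteSpace F] (J : IsCylJet T u a b aa bb) (t : ℝ) :
    ∫ θ in (0 : ℝ)..(2 * π), bb (t, θ) = 0 := by
  rw [intervalIntegral.integral_eq_sub_of_hasDerivAt (fun θ _ => J.deriv_θθ t θ)
    ((continuous_slice J.cont_θθ t).intervalIntegrable _ _)]
  simpa [sub_eq_zero] using J.periodic_θ t 0

theorem circleInt_inner_θθ (J : IsCylJet T u a b aa bb) (t : ℝ) :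
    ∫ θ in (0 : ℝ)..(2 * π), (‖b (t, θ)‖ ^ 2 + inner ℝ (u (t, θ)) (bb (t, θ))) = 0 := by
  have hu := J.cont
  have hb := J.cont_θ
  have hbb := J.cont_θθ
  have hd (θ : ℝ) : HasDerivAt (fun θ => inner ℝ (u (t, θ)) (b (t, θ)))
      (‖b (t, θ)‖ ^ 2 + inner ℝ (u (t, θ)) (bb (t, θ))) θ := by
    refine ((J.deriv_θ t θ).inner ℝ (J.deriv_θθ t θ)).congr_deriv ?_
    rw [real_inner_self_eq_norm_sq, add_comm]
  rw [intervalIntegral.integral_eq_sub_of_hasDerivAt (fun θ _ => hd θ)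
    (Continuous.intervalIntegrable (by fun_prop) _ _)]
  have h1 := J.periodic_θ t 0
  have h2 := J.periodic t 0
  simp only [zero_add] at h1 h2
  rw [h1, h2, sub_self]

/-- Testing the Laplacian of `u` against `w(t) u`, for a weight `w` vanishing at both ends. -/
theorem weighted_energy (J : IsCylJet T u a b aa bb) (hT : 0 ≤ T) {w w' : ℝ → ℝ}
    (hw : ∀ t, HasDerivAt w (w' t) t) (hw' : Continuous w') (h0 : w 0 = 0) (h1 : w T = 0) :
    cylInt 0 T (fun p => w p.1 * (‖a p‖ ^ 2 + ‖b p‖ ^ 2 + inner ℝ (u p) (aa p + bb p)) +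
      w' p.1 * inner ℝ (u p) (a p)) = 0 := by
  have hu := J.cont
  have ha := J.cont_t
  have hb := J.cont_θ
  have haa := J.cont_tt
  have hbb := J.cont_θθ
  have hwc : Continuous w := continuous_iff_continuousAt.2 fun x => (hw x).continuousAt
  have hA : cylInt 0 T (fun p => w' p.1 * inner ℝ (u p) (a p) +
      w p.1 * (‖a p‖ ^ 2 + inner ℝ (u p) (aa p))) = 0 := by
    rw [← circleInt_sub_circleInt (T := T) (g := fun p => w p.1 * inner ℝ (u p) (a p))
      (by fun_prop) (by fun_prop) _ (Set.left_mem_Icc.2 hT) (Set.right_mem_Icc.2 hT)]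
    · simp [h0, h1]
    · intro t ht θ
      refine ((hw t).mul ((J.deriv_t t ht θ).inner ℝ (J.deriv_tt t ht θ))).congr_deriv ?_
      simp only [real_inner_self_eq_norm_sq]
      ring
  have hB : cylInt 0 T (fun p => w p.1 * (‖b p‖ ^ 2 + inner ℝ (u p) (bb p))) = 0 := by
    simp [cylInt, intervalIntegral.integral_const_mul, J.circleInt_inner_θθ]
  refine Eq.trans ?_ ((cylInt_add (by fun_prop) (by fun_prop)).trans
    ((congrArg₂ (· + ·) hA hB).trans (add_zero 0)))
  congr 1
  funext p
  rw [inner_add_right]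
  ring

/-- A bound for the circle means in terms of their values at `L` and `2L` and the Laplacian. -/
theorem norm_circleInt_le [CompleteSpace F] {L η : ℝ} (hL : 1 ≤ L)
    (J : IsCylJet (3 * L) u a b aa bb)
    (h1 : ‖∫ θ in (0 : ℝ)..(2 * π), u (L, θ)‖ ≤ η)
    (h2 : ‖∫ θ in (0 : ℝ)..(2 * π), u (2 * L, θ)‖ ≤ η) {t : ℝ} (ht : t ∈ Set.Icc 0 (3 * L)) :
    ‖∫ θ in (0 : ℝ)..(2 * π), u (t, θ)‖ ≤
      7 * L * η + 3 * L * cylInt 0 (3 * L) (fun p => ‖aa p + bb p‖) := by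
  set K := cylInt 0 (3 * L) (fun p => ‖aa p + bb p‖) with hK
  set m : ℝ → F := fun t => ∫ θ in (0 : ℝ)..(2 * π), u (t, θ) with hm
  set q : ℝ → F := fun t => ∫ θ in (0 : ℝ)..(2 * π), a (t, θ) with hq
  have haa := J.cont_tt
  have hbb := J.cont_θθ
  have hqc : Continuous q := continuous_circleInt J.cont_t
  have hη : 0 ≤ η := (norm_nonneg _).trans h1
  have mem1 : L ∈ Set.Icc 0 (3 * L) := ⟨by linarith, by linarith⟩
  have mem2 : 2 * L ∈ Set.Icc 0 (3 * L) := ⟨by linarith, by linarith⟩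
  have hmsub {s t : ℝ} (hs : s ∈ Set.Icc 0 (3 * L)) (ht : t ∈ Set.Icc 0 (3 * L)) :
      m t - m s = ∫ r in s..t, q r :=
    circleInt_sub_circleInt J.cont J.cont_t J.deriv_t hs ht
  have hqsub {s t : ℝ} (hs : s ∈ Set.Icc 0 (3 * L)) (ht : t ∈ Set.Icc 0 (3 * L)) :
      ‖q t - q s‖ ≤ K := by
    have e1 : q t - q s = ∫ r in s..t, ∫ θ in (0 : ℝ)..(2 * π), (aa (r, θ) + bb (r, θ)) := by
      rw [hq, circleInt_sub_circleInt J.cont_t J.cont_tt J.deriv_tt hs ht, cylInt]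
      congr 1 with r
      rw [intervalIntegral.integral_add ((continuous_slice haa r).intervalIntegrable _ _)
        ((continuous_slice hbb r).intervalIntegrable _ _), J.circleInt_θθ, add_zero]
    have hc : Continuous fun r => ∫ θ in (0 : ℝ)..(2 * π), (aa (r, θ) + bb (r, θ)) :=
      continuous_circleInt (g := fun p => aa p + bb p) (by fun_prop)
    have hc' : Continuous fun r => ∫ θ in (0 : ℝ)..(2 * π), ‖aa (r, θ) + bb (r, θ)‖ :=
      continuous_circleInt (g := fun p => ‖aa p + bb p‖) (by fun_prop)
    have h2π : (0 : ℝ) ≤ 2 * π := by positivity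
    calc ‖q t - q s‖ ≤ |∫ r in s..t, ‖∫ θ in (0 : ℝ)..(2 * π), (aa (r, θ) + bb (r, θ))‖| := by
          rw [e1]; exact intervalIntegral.norm_integral_le_abs_integral_norm
      _ ≤ |∫ r in (0 : ℝ)..(3 * L), ‖∫ θ in (0 : ℝ)..(2 * π), (aa (r, θ) + bb (r, θ))‖| := by
          refine intervalIntegral.abs_integral_mono_interval ?_
            (Filter.Eventually.of_forall fun r => norm_nonneg _) (hc.norm.intervalIntegrable _ _)
          rw [Set.uIoc, Set.uIoc_of_le (by linarith)]
          exact Set.Ioc_subset_Ioc (le_min hs.1 ht.1) (max_le hs.2 ht.2)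
      _ = ∫ r in (0 : ℝ)..(3 * L), ‖∫ θ in (0 : ℝ)..(2 * π), (aa (r, θ) + bb (r, θ))‖ :=
          abs_of_nonneg (intervalIntegral.integral_nonneg (by linarith) fun _ _ => norm_nonneg _)
      _ ≤ K := intervalIntegral.integral_mono (by linarith) (hc.norm.intervalIntegrable _ _)
          (hc'.intervalIntegrable _ _) fun r => intervalIntegral.norm_integral_le_integral_norm h2π
  have hqle {t : ℝ} (ht : t ∈ Set.Icc 0 (3 * L)) : ‖q t‖ ≤ 2 * η + K := by
    have e : L • q t = (m (2 * L) - m L) - ∫ r in L..(2 * L), (q r - q t) := by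
      rw [hmsub mem1 mem2, intervalIntegral.integral_sub (hqc.intervalIntegrable _ _)
        (continuous_const.intervalIntegrable _ _), intervalIntegral.integral_const]
      rw [show 2 * L - L = L by ring, sub_sub_cancel]
    have e2 : ‖∫ r in L..(2 * L), (q r - q t)‖ ≤ K * |2 * L - L| := by
      refine intervalIntegral.norm_integral_le_of_norm_le_const fun r hr => hqsub ht ?_
      rw [Set.uIoc_of_le (by linarith)] at hr
      exact ⟨by linarith [hr.1], by linarith [hr.2]⟩
    rw [show 2 * L - L = L by ring, abs_of_pos (by linarith)] at e2
    have e3 : L * ‖q t‖ ≤ 2 * η + K * L := by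
      calc L * ‖q t‖ = ‖L • q t‖ := by rw [norm_smul, Real.norm_of_nonneg (by linarith)]
        _ ≤ ‖m (2 * L)‖ + ‖m L‖ + K * L := by
          rw [e]
          exact (norm_sub_le _ _).trans (add_le_add (norm_sub_le _ _) e2)
        _ ≤ 2 * η + K * L := by linarith
    nlinarith
  have e4 : ‖m t - m L‖ ≤ (2 * η + K) * |t - L| := by
    rw [hmsub mem1 ht]
    refine intervalIntegral.norm_integral_le_of_norm_le_const fun r hr => hqle ?_
    exact ⟨(le_min mem1.1 ht.1).trans hr.1.le, hr.2.trans (max_le mem1.2 ht.2)⟩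
  have hK0 : 0 ≤ K := cylInt_nonneg (by linarith) fun _ => norm_nonneg _
  have e5 : |t - L| ≤ 2 * L := abs_le.2 ⟨by linarith [ht.1], by linarith [ht.2]⟩
  have e6 := mul_le_mul_of_nonneg_left e5 (by positivity : 0 ≤ 2 * η + K)
  have e7 : ‖m t‖ ≤ ‖m L‖ + ‖m t - m L‖ := norm_le_insert' _ _
  nlinarith

end Inner

end IsCylJet

/-- The weight used in the energy estimate; it vanishes at `0` and `3L`. -/
noncomputable def cylWeight (L t : ℝ) : ℝ :=
  (cosh (3 / 2 * (t - 3 / 2 * L)))⁻¹ - (cosh (9 / 4 * L))⁻¹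

/-- Derivative of `cylWeight`. -/
noncomputable def cylWeightDeriv (L t : ℝ) : ℝ :=
  -(3 / 2 * sinh (3 / 2 * (t - 3 / 2 * L))) / cosh (3 / 2 * (t - 3 / 2 * L)) ^ 2

theorem hasDerivAt_cylWeight (L t : ℝ) :
    HasDerivAt (cylWeight L) (cylWeightDeriv L t) t := by
  have h1 : HasDerivAt (fun t => 3 / 2 * (t - 3 / 2 * L)) (3 / 2) t := by
    simpa using ((hasDerivAt_id t).sub_const (3 / 2 * L)).const_mul (3 / 2)
  refine ((h1.cosh.inv (cosh_pos _).ne').sub_const _).congr_deriv ?_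
  rw [cylWeightDeriv]
  ring

theorem continuous_cylWeight (L : ℝ) : Continuous (cylWeight L) :=
  continuous_iff_continuousAt.2 fun t => (hasDerivAt_cylWeight L t).continuousAt

theorem continuous_cylWeightDeriv (L : ℝ) : Continuous (cylWeightDeriv L) := by
  unfold cylWeightDeriv
  exact Continuous.div (by fun_prop) (by fun_prop) fun t => (pow_pos (cosh_pos _) 2).ne'

theorem cylWeight_zero (L : ℝ) : cylWeight L 0 = 0 := by
  rw [cylWeight, ← cosh_neg, show -(3 / 2 * (0 - 3 / 2 * L)) = 9 / 4 * L by ring, sub_self]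

theorem cylWeight_end (L : ℝ) : cylWeight L (3 * L) = 0 := by
  rw [cylWeight, show 3 / 2 * (3 * L - 3 / 2 * L) = 9 / 4 * L by ring, sub_self]

theorem cylWeight_nonneg {L t : ℝ} (ht : t ∈ Set.Icc 0 (3 * L)) : 0 ≤ cylWeight L t := by
  have hL : 0 ≤ L := by linarith [ht.1.trans ht.2]
  refine sub_nonneg.2 (inv_anti₀ (cosh_pos _) (cosh_le_cosh.2 ?_))
  rw [abs_of_nonneg (by positivity : 0 ≤ 9 / 4 * L)]
  exact abs_le.2 ⟨by linarith [ht.1], by linarith [ht.2]⟩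

theorem cylWeight_le_one (L t : ℝ) : cylWeight L t ≤ 1 := by
  have h1 : (cosh (3 / 2 * (t - 3 / 2 * L)))⁻¹ ≤ 1 := inv_le_one_of_one_le₀ (one_le_cosh _)
  have h2 : 0 < (cosh (9 / 4 * L))⁻¹ := inv_pos.2 (cosh_pos _)
  rw [cylWeight]
  linarith

theorem le_cylWeight {L t : ℝ} (ht : t ∈ Set.Icc L (2 * L)) :
    (cosh (3 / 4 * L))⁻¹ - (cosh (9 / 4 * L))⁻¹ ≤ cylWeight L t := by
  have hL : 0 ≤ L := by linarith [ht.1.trans ht.2]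
  refine sub_le_sub_right (inv_anti₀ (cosh_pos _) (cosh_le_cosh.2 ?_)) _
  rw [abs_of_nonneg (by positivity : 0 ≤ 3 / 4 * L)]
  exact abs_le.2 ⟨by linarith [ht.1], by linarith [ht.2]⟩

theorem abs_cylWeightDeriv_le (L t : ℝ) :
    |cylWeightDeriv L t| ≤ 3 / 2 * (cylWeight L t + (cosh (9 / 4 * L))⁻¹) := by
  rw [cylWeight, sub_add_cancel, cylWeightDeriv]
  set x := 3 / 2 * (t - 3 / 2 * L)
  have hc := cosh_pos x
  have hs : |sinh x| ≤ cosh x := by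
    refine abs_le_of_sq_le_sq ?_ hc.le
    linarith [cosh_sq x]
  rw [abs_div, abs_neg, abs_mul, abs_of_pos (by norm_num : (0 : ℝ) < 3 / 2),
    abs_of_pos (pow_pos hc 2), div_le_iff₀ (pow_pos hc 2)]
  calc 3 / 2 * |sinh x| ≤ 3 / 2 * cosh x := by gcongr
    _ = 3 / 2 * (cosh x)⁻¹ * cosh x ^ 2 := by field_simp

/-- Pointwise estimate of the integrand in `IsCylJet.weighted_energy`. -/
theorem energy_integrand_le {F : Type*} [NormedAddCommGroup F] [InnerProductSpace ℝ F]
    {w w' g δ : ℝ} (hδ : 0 < δ) (hwn : 0 ≤ w) (hw1 : w ≤ 1) (hg0 : 0 ≤ g)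
    (hd : |w'| ≤ 3 / 2 * (w + g)) (u a b f : F) :
    1 / 8 * (w * (‖u‖ ^ 2 + ‖a‖ ^ 2 + ‖b‖ ^ 2)) + 7 / 8 * (w * ‖b‖ ^ 2) ≤
      (w * (‖a‖ ^ 2 + ‖b‖ ^ 2 + inner ℝ u f) + w' * inner ℝ u a) + (7 / 8 * (w * ‖u‖ ^ 2) +
        ((3 / 4 * g + δ / 2) * (‖u‖ ^ 2 + ‖a‖ ^ 2 + ‖b‖ ^ 2) + (2 * δ)⁻¹ * ‖f‖ ^ 2)) := by
  have i1 := abs_real_inner_le_norm u f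
  have i2 := abs_real_inner_le_norm u a
  generalize inner ℝ u f = x at *
  generalize inner ℝ u a = y at *
  have j1 : -(w' * y) ≤ 3 / 4 * (w + g) * (‖u‖ ^ 2 + ‖a‖ ^ 2) := by
    calc -(w' * y) ≤ |w'| * |y| := by rw [← abs_mul]; exact neg_le_abs _
      _ ≤ (3 / 2 * (w + g)) * (‖u‖ * ‖a‖) := by gcongr
      _ ≤ 3 / 4 * (w + g) * (‖u‖ ^ 2 + ‖a‖ ^ 2) := by
        nlinarith [mul_nonneg (add_nonneg hwn hg0) (sq_nonneg (‖u‖ - ‖a‖))]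
  have j2 : -(w * x) ≤ δ / 2 * ‖u‖ ^ 2 + (2 * δ)⁻¹ * ‖f‖ ^ 2 := by
    have h1 : δ / 2 * ‖u‖ ^ 2 + (2 * δ)⁻¹ * ‖f‖ ^ 2 - ‖u‖ * ‖f‖ =
        (2 * δ)⁻¹ * (δ * ‖u‖ - ‖f‖) ^ 2 := by
      field_simp
      ring
    have h0 : 0 ≤ (2 * δ)⁻¹ * (δ * ‖u‖ - ‖f‖) ^ 2 := by positivity
    calc -(w * x) ≤ w * |x| := by nlinarith [neg_abs_le x]
      _ ≤ 1 * |x| := by gcongr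
      _ ≤ _ := by linarith
  have j3 : 0 ≤ (3 / 4 * g + δ / 2) * ‖b‖ ^ 2 := by positivity
  have j4 : 0 ≤ δ / 2 * ‖a‖ ^ 2 := by positivity
  have j5 : 0 ≤ w * ‖a‖ ^ 2 := by positivity
  nlinarith

/-- The constant in front of the perturbation terms in `IsCylJet.middle_le`. -/
noncomputable def cylConst (L : ℝ) : ℝ := 10 + 3 * L * (31 * L + 30 * L ^ 2) ^ 2

namespace IsCylJet

variable {k : ℕ} {L δ M : ℝ} {u a b aa bb : ℝ × ℝ → EuclideanSpace ℝ (Fin k)}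

theorem weighted_wirtinger {T μ : ℝ} (hT : 0 ≤ T) (J : IsCylJet T u a b aa bb) {w : ℝ → ℝ}
    (hw : Continuous w) (hw0 : ∀ t ∈ Set.Icc 0 T, 0 ≤ w t) (hw1 : ∀ t, w t ≤ 1)
    (hm : ∀ t ∈ Set.Icc 0 T, ‖∫ θ in (0 : ℝ)..(2 * π), u (t, θ)‖ ≤ μ) :
    cylInt 0 T (fun p => w p.1 * ‖u p‖ ^ 2) ≤
      cylInt 0 T (fun p => w p.1 * ‖b p‖ ^ 2) + T * μ ^ 2 := by
  have hu := J.cont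
  have hb := J.cont_θ
  have hcu := continuous_circleInt (g := fun p => w p.1 * ‖u p‖ ^ 2) (by fun_prop)
  have hcb := continuous_circleInt (g := fun p => w p.1 * ‖b p‖ ^ 2) (by fun_prop)
  have hsum : cylInt 0 T (fun p => w p.1 * ‖b p‖ ^ 2) + T * μ ^ 2 =
      ∫ t in (0 : ℝ)..T, ((∫ θ in (0 : ℝ)..(2 * π), w t * ‖b (t, θ)‖ ^ 2) + μ ^ 2) := by
    rw [intervalIntegral.integral_add (hcb.intervalIntegrable _ _)
      (continuous_const.intervalIntegrable _ _)]
    simp [cylInt]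
  rw [hsum]
  refine intervalIntegral.integral_mono_on hT (hcu.intervalIntegrable _ _)
    ((hcb.add continuous_const).intervalIntegrable _ _) fun t ht => ?_
  simp only [intervalIntegral.integral_const_mul]
  have h1 := wirtinger_euclidean (J.deriv_θ t) (continuous_slice hb t)
    (by simpa using J.periodic t 0)
  have h2 := pow_le_pow_left₀ (norm_nonneg _) (hm t ht) 2
  have h3 := mul_le_mul_of_nonneg_left (h1.trans (add_le_add_right h2 _)) (hw0 t ht)
  nlinarith [mul_le_mul_of_nonneg_right (hw1 t) (sq_nonneg μ)]

/-- The energy on the middle annulus is controlled by a small multiple of the total energy, up to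
perturbation terms. -/
theorem middle_le (hL : 1 ≤ L) (hδ : 0 < δ) (hδ1 : δ ≤ 1) (hM : 0 < M)
    (J : IsCylJet (3 * L) u a b aa bb)
    (hN : cylInt 0 (3 * L) (fun p => ‖u p‖ ^ 2 + ‖a p‖ ^ 2 + ‖b p‖ ^ 2) ≤ 3 * M ^ 2)
    (hf : cylInt 0 (3 * L) (fun p => ‖aa p + bb p‖ ^ 2) ≤ 16 * δ ^ 2 * M ^ 2)
    (h1 : ‖∫ θ in (0 : ℝ)..(2 * π), u (L, θ)‖ ≤ δ * M)
    (h2 : ‖∫ θ in (0 : ℝ)..(2 * π), u (2 * L, θ)‖ ≤ δ * M) :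
    ((cosh (3 / 4 * L))⁻¹ - (cosh (9 / 4 * L))⁻¹) / 8 *
        cylInt L (2 * L) (fun p => ‖u p‖ ^ 2 + ‖a p‖ ^ 2 + ‖b p‖ ^ 2) ≤
      3 / 4 * (cosh (9 / 4 * L))⁻¹ *
        cylInt 0 (3 * L) (fun p => ‖u p‖ ^ 2 + ‖a p‖ ^ 2 + ‖b p‖ ^ 2) +
      cylConst L * δ * M ^ 2 := by
  have hu := J.cont
  have ha := J.cont_t
  have hb := J.cont_θ
  have haa := J.cont_tt
  have hbb := J.cont_θθ
  have hw := continuous_cylWeight L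
  have hw' := continuous_cylWeightDeriv L
  have hT : 0 ≤ 3 * L := by linarith
  set g := (cosh (9 / 4 * L))⁻¹ with hg
  have hg0 : 0 < g := inv_pos.2 (cosh_pos _)
  have hδM : 0 < δ * M := mul_pos hδ hM
  set e : ℝ × ℝ → ℝ := fun p => ‖u p‖ ^ 2 + ‖a p‖ ^ 2 + ‖b p‖ ^ 2 with he
  have hec : Continuous e := by fun_prop
  have he0 (p : ℝ × ℝ) : 0 ≤ e p := by positivity
  have hK : cylInt 0 (3 * L) (fun p => ‖aa p + bb p‖) ≤ (10 * L + 8) * (δ * M) := by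
    have := cylInt_mono hT (f := fun p => ‖aa p + bb p‖)
      (g := fun p => δ * M / 2 + (2 * (δ * M))⁻¹ * ‖aa p + bb p‖ ^ 2) (by fun_prop)
      (by fun_prop) fun r _ θ => by
        have : δ * M / 2 + (2 * (δ * M))⁻¹ * ‖aa (r, θ) + bb (r, θ)‖ ^ 2 -
            ‖aa (r, θ) + bb (r, θ)‖ =
            (2 * (δ * M))⁻¹ * (δ * M - ‖aa (r, θ) + bb (r, θ)‖) ^ 2 := by
          field_simp
          ring
        have h0 : 0 ≤ (2 * (δ * M))⁻¹ * (δ * M - ‖aa (r, θ) + bb (r, θ)‖) ^ 2 := by positivity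
        linarith
    rw [cylInt_add (by fun_prop) (by fun_prop), cylInt_const_mul] at this
    have hc : cylInt 0 (3 * L) (fun _ => δ * M / 2) = 3 * L * (π * (δ * M)) := by
      simp [cylInt]
      ring
    have h3 : (2 * (δ * M))⁻¹ * cylInt 0 (3 * L) (fun p => ‖aa p + bb p‖ ^ 2) ≤ 8 * (δ * M) := by
      calc _ ≤ (2 * (δ * M))⁻¹ * (16 * δ ^ 2 * M ^ 2) := by gcongr
        _ = 8 * (δ * M) := by field_simp; norm_num
    rw [hc] at this
    nlinarith [pi_lt_d2, mul_pos (by linarith : 0 < L) hδM]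
  set μ := (31 * L + 30 * L ^ 2) * (δ * M) with hμ
  have hm (t : ℝ) (ht : t ∈ Set.Icc 0 (3 * L)) :
      ‖∫ θ in (0 : ℝ)..(2 * π), u (t, θ)‖ ≤ μ := by
    have := J.norm_circleInt_le hL h1 h2 ht
    nlinarith
  have hW := J.weighted_wirtinger hT hw (fun t ht => cylWeight_nonneg ht) (cylWeight_le_one L) hm
  have hE := J.weighted_energy hT (hasDerivAt_cylWeight L) hw' (cylWeight_zero L)
    (cylWeight_end L)
  have hpt := cylInt_mono hT
    (f := fun p => 1 / 8 * (cylWeight L p.1 * e p) + 7 / 8 * (cylWeight L p.1 * ‖b p‖ ^ 2))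
    (g := fun p => (cylWeight L p.1 * (‖a p‖ ^ 2 + ‖b p‖ ^ 2 + inner ℝ (u p) (aa p + bb p)) +
      cylWeightDeriv L p.1 * inner ℝ (u p) (a p)) + (7 / 8 * (cylWeight L p.1 * ‖u p‖ ^ 2) +
      ((3 / 4 * g + δ / 2) * e p + (2 * δ)⁻¹ * ‖aa p + bb p‖ ^ 2)))
    (by fun_prop) (by fun_prop) fun t ht θ =>
      energy_integrand_le hδ (cylWeight_nonneg (Set.Ioo_subset_Icc_self ht))
        (cylWeight_le_one L t) hg0.le (abs_cylWeightDeriv_le L t) _ _ _ _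
  have s1 : cylInt 0 (3 * L) (fun p => (3 / 4 * g + δ / 2) * e p +
      (2 * δ)⁻¹ * ‖aa p + bb p‖ ^ 2) = (3 / 4 * g + δ / 2) * cylInt 0 (3 * L) e +
      (2 * δ)⁻¹ * cylInt 0 (3 * L) (fun p => ‖aa p + bb p‖ ^ 2) := by
    rw [← cylInt_const_mul, ← cylInt_const_mul]
    exact cylInt_add (by fun_prop) (by fun_prop)
  have s2 : cylInt 0 (3 * L) (fun p => 7 / 8 * (cylWeight L p.1 * ‖u p‖ ^ 2) +
      ((3 / 4 * g + δ / 2) * e p + (2 * δ)⁻¹ * ‖aa p + bb p‖ ^ 2)) =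
      7 / 8 * cylInt 0 (3 * L) (fun p => cylWeight L p.1 * ‖u p‖ ^ 2) +
      ((3 / 4 * g + δ / 2) * cylInt 0 (3 * L) e +
      (2 * δ)⁻¹ * cylInt 0 (3 * L) (fun p => ‖aa p + bb p‖ ^ 2)) := by
    rw [← s1, ← cylInt_const_mul]
    exact cylInt_add (by fun_prop) (by fun_prop)
  have s3 : cylInt 0 (3 * L) (fun p => 1 / 8 * (cylWeight L p.1 * e p) +
      7 / 8 * (cylWeight L p.1 * ‖b p‖ ^ 2)) =
      1 / 8 * cylInt 0 (3 * L) (fun p => cylWeight L p.1 * e p) +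
      7 / 8 * cylInt 0 (3 * L) (fun p => cylWeight L p.1 * ‖b p‖ ^ 2) := by
    rw [← cylInt_const_mul, ← cylInt_const_mul]
    exact cylInt_add (by fun_prop) (by fun_prop)
  rw [s3, cylInt_add (by fun_prop) (by fun_prop), hE, s2, zero_add] at hpt
  have hmid : (((cosh (3 / 4 * L))⁻¹ - g)) * cylInt L (2 * L) e ≤
      cylInt 0 (3 * L) (fun p => cylWeight L p.1 * e p) := by
    have hwe : Continuous fun p : ℝ × ℝ => cylWeight L p.1 * e p := by fun_prop
    rw [← cylInt_const_mul, ← cylInt_add_adjacent (s := L) hwe,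
      ← cylInt_add_adjacent (r := L) (s := 2 * L) (t := 3 * L) hwe]
    have k1 : 0 ≤ cylInt 0 L (fun p => cylWeight L p.1 * e p) := by
      simpa [cylInt] using cylInt_mono (by linarith : 0 ≤ L) (f := fun _ => 0) (by fun_prop) hwe
        fun t ht θ => mul_nonneg
          (cylWeight_nonneg ⟨ht.1.le, by linarith [ht.2]⟩) (he0 _)
    have k3 : 0 ≤ cylInt (2 * L) (3 * L) (fun p => cylWeight L p.1 * e p) := by
      simpa [cylInt] using cylInt_mono (by linarith : 2 * L ≤ 3 * L) (f := fun _ => 0)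
        (by fun_prop) hwe fun t ht θ => mul_nonneg
          (cylWeight_nonneg ⟨by linarith [ht.1], by linarith [ht.2]⟩) (he0 _)
    have k2 := cylInt_mono (by linarith : L ≤ 2 * L)
      (f := fun p => ((cosh (3 / 4 * L))⁻¹ - g) * e p) (by fun_prop) hwe fun t ht θ =>
        mul_le_mul_of_nonneg_right (le_cylWeight (Set.Ioo_subset_Icc_self ht)) (he0 _)
    linarith
  have hf' : (2 * δ)⁻¹ * cylInt 0 (3 * L) (fun p => ‖aa p + bb p‖ ^ 2) ≤ 8 * δ * M ^ 2 := by
    calc _ ≤ (2 * δ)⁻¹ * (16 * δ ^ 2 * M ^ 2) := by gcongr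
      _ = 8 * δ * M ^ 2 := by field_simp; norm_num
  have hNδ : δ / 2 * cylInt 0 (3 * L) e ≤ 3 / 2 * δ * M ^ 2 := by nlinarith
  have hμ2 : 3 * L * μ ^ 2 ≤ 3 * L * (31 * L + 30 * L ^ 2) ^ 2 * (δ * M ^ 2) := by
    have : δ ^ 2 ≤ δ := by nlinarith
    calc 3 * L * μ ^ 2 = 3 * L * (31 * L + 30 * L ^ 2) ^ 2 * (δ ^ 2 * M ^ 2) := by rw [hμ]; ring
      _ ≤ _ := by gcongr
  have hp : 0 ≤ 3 * L * μ ^ 2 := by positivity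
  have hδM2 : 0 < δ * M ^ 2 := by positivity
  rw [cylConst]
  nlinarith

end IsCylJet

/-- The choice of `δ` in terms of `L`. -/
noncomputable def cylDelta (L : ℝ) : ℝ := exp (-(2 * L)) / (20 * cylConst L)

theorem cylConst_ge {L : ℝ} (hL : 0 ≤ L) : 10 ≤ cylConst L := by
  rw [cylConst]
  nlinarith [mul_nonneg hL (sq_nonneg (31 * L + 30 * L ^ 2))]

theorem cylDelta_pos {L : ℝ} (hL : 0 ≤ L) : 0 < cylDelta L := by
  have := cylConst_ge hL
  rw [cylDelta]
  positivity

theorem cylDelta_le_one {L : ℝ} (hL : 0 ≤ L) : cylDelta L ≤ 1 := by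
  have := cylConst_ge hL
  have h1 : exp (-(2 * L)) ≤ 1 := exp_le_one_iff.2 (by linarith)
  rw [cylDelta, div_le_one (by positivity)]
  linarith

theorem cyl_constants {L : ℝ} (hL : 160 ≤ L) :
    18 * (cosh (9 / 4 * L))⁻¹ * exp L + 8 * cylConst L * cylDelta L * exp L <
      (cosh (3 / 4 * L))⁻¹ - (cosh (9 / 4 * L))⁻¹ := by
  have hC := cylConst_ge (by linarith : 0 ≤ L)
  have h1 : exp (-(3 / 4 * L)) ≤ (cosh (3 / 4 * L))⁻¹ := by
    rw [exp_neg]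
    refine inv_anti₀ (cosh_pos _) ?_
    rw [cosh_eq]
    linarith [exp_le_exp.2 (by linarith : -(3 / 4 * L) ≤ 3 / 4 * L)]
  have h2 : (cosh (9 / 4 * L))⁻¹ ≤ 2 * exp (-(9 / 4 * L)) := by
    rw [exp_neg, ← div_eq_mul_inv, inv_eq_one_div, div_le_div_iff₀ (cosh_pos _) (exp_pos _),
      cosh_eq]
    linarith [exp_pos (-(9 / 4 * L))]
  have h3 : 8 * cylConst L * cylDelta L * exp L = 2 / 5 * exp (-L) := by
    rw [cylDelta, show -L = -(2 * L) + L by ring, exp_add]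
    field_simp
    norm_num
  have h4 : exp (-(9 / 4 * L)) * exp L = exp (-(3 / 4 * L)) * exp (-(1 / 2 * L)) := by
    rw [← exp_add, ← exp_add]
    ring_nf
  have h5 : exp (-L) ≤ exp (-(3 / 4 * L)) := exp_le_exp.2 (by linarith)
  have h6 : exp (-(1 / 2 * L)) ≤ 1 / 81 := by
    rw [exp_neg, inv_eq_one_div]
    refine one_div_le_one_div_of_le (by norm_num) ?_
    linarith [add_one_le_exp (1 / 2 * L)]
  have h7 : 1 ≤ exp L := one_le_exp (by linarith)
  have h8 := exp_pos (-(3 / 4 * L))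
  have h9 := inv_pos.2 (cosh_pos (9 / 4 * L))
  have h10 : (cosh (9 / 4 * L))⁻¹ * exp L ≤ 2 * (exp (-(3 / 4 * L)) * exp (-(1 / 2 * L))) := by
    rw [← h4]
    nlinarith
  nlinarith

/-- Three annuli inequality for a jet whose Laplacian is dominated by its first-order terms and a
small inhomogeneity. -/
theorem IsCylJet.three_annuli {k : ℕ} {L M N₁ N₂ N₃ : ℝ} (hL : 160 ≤ L)
    {u a b aa bb h : ℝ × ℝ → EuclideanSpace ℝ (Fin k)} (J : IsCylJet (3 * L) u a b aa bb)
    (hh : Continuous h)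
    (hf : ∀ t ∈ Set.Ioo 0 (3 * L), ∀ θ, ‖aa (t, θ) + bb (t, θ)‖ ≤
      ‖h (t, θ)‖ + cylDelta L * (‖u (t, θ)‖ + ‖a (t, θ)‖ + ‖b (t, θ)‖))
    (hN₁ : N₁ = cylInt 0 L (fun p => ‖u p‖ ^ 2 + ‖a p‖ ^ 2 + ‖b p‖ ^ 2))
    (hN₂ : N₂ = cylInt L (2 * L) (fun p => ‖u p‖ ^ 2 + ‖a p‖ ^ 2 + ‖b p‖ ^ 2))
    (hN₃ : N₃ = cylInt (2 * L) (3 * L) (fun p => ‖u p‖ ^ 2 + ‖a p‖ ^ 2 + ‖b p‖ ^ 2))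
    (hM : M = max (√N₁) (max (√N₂) (√N₃)))
    (hhM : √(cylInt 0 (3 * L) (fun p => ‖h p‖ ^ 2)) ≤ cylDelta L * M)
    (h1 : ‖∫ θ in (0 : ℝ)..(2 * π), u (L, θ)‖ ≤ cylDelta L * M)
    (h2 : ‖∫ θ in (0 : ℝ)..(2 * π), u (2 * L, θ)‖ ≤ cylDelta L * M) :
    √N₂ ≤ exp (-(L / 2)) * √N₁ ∨ √N₂ ≤ exp (-(L / 2)) * √N₃ := by
  have hu := J.cont
  have ha := J.cont_t
  have hb := J.cont_θ
  have haa := J.cont_tt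
  have hbb := J.cont_θθ
  by_contra! hcon
  have hT : 0 ≤ 3 * L := by linarith
  have hδ := cylDelta_pos (by linarith : 0 ≤ L)
  have hδ1 := cylDelta_le_one (by linarith : 0 ≤ L)
  have hconst := cyl_constants hL
  have hC := cylConst_ge (by linarith : 0 ≤ L)
  set δ := cylDelta L
  set e : ℝ × ℝ → ℝ := fun p => ‖u p‖ ^ 2 + ‖a p‖ ^ 2 + ‖b p‖ ^ 2 with he
  have hec : Continuous e := by fun_prop
  have he0 (p : ℝ × ℝ) : 0 ≤ e p := by positivity
  have hN₁0 : 0 ≤ N₁ := hN₁ ▸ cylInt_nonneg (by linarith) he0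
  have hN₂0 : 0 ≤ N₂ := hN₂ ▸ cylInt_nonneg (by linarith) he0
  have hN₃0 : 0 ≤ N₃ := hN₃ ▸ cylInt_nonneg (by linarith) he0
  have hN : cylInt 0 (3 * L) e = N₁ + N₂ + N₃ := by
    rw [hN₁, hN₂, hN₃, cylInt_add_adjacent hec, cylInt_add_adjacent hec]
  have le_exp_mul {N : ℝ} (h0 : 0 ≤ N) (hlt : exp (-(L / 2)) * √N < √N₂) :
      N ≤ exp L * N₂ := by
    have hsq := pow_le_pow_left₀ (by positivity) hlt.le 2
    rw [mul_pow, sq_sqrt h0, sq_sqrt hN₂0, ← exp_nat_mul,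
      show ((2 : ℕ) : ℝ) * -(L / 2) = -L by push_cast; ring] at hsq
    calc N = exp L * (exp (-L) * N) := by rw [← mul_assoc, ← exp_add]; simp
      _ ≤ exp L * N₂ := by gcongr
  have hle₁ := le_exp_mul hN₁0 hcon.1
  have hle₃ := le_exp_mul hN₃0 hcon.2
  have hexp : 1 ≤ exp L := one_le_exp (by linarith)
  have hle₂ : N₂ ≤ exp L * N₂ := le_mul_of_one_le_left hN₂0 hexp
  have hN₂pos : 0 < N₂ := sqrt_pos.1 (lt_of_le_of_lt (by positivity) hcon.1)
  have hMpos : 0 < M := hM ▸ lt_max_of_lt_right (lt_max_of_lt_left (sqrt_pos.2 hN₂pos))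
  have hM₁ : N₁ ≤ M ^ 2 := (sqrt_le_left hMpos.le).1 (hM ▸ le_max_left _ _)
  have hM₂ : N₂ ≤ M ^ 2 :=
    (sqrt_le_left hMpos.le).1 (hM ▸ (le_max_left _ _).trans (le_max_right _ _))
  have hM₃ : N₃ ≤ M ^ 2 :=
    (sqrt_le_left hMpos.le).1 (hM ▸ (le_max_right _ _).trans (le_max_right _ _))
  have hMle : M ^ 2 ≤ exp L * N₂ := by
    refine (le_sqrt hMpos.le (by positivity)).1 (hM ▸ ?_)
    exact max_le (sqrt_le_sqrt hle₁) (max_le (sqrt_le_sqrt hle₂) (sqrt_le_sqrt hle₃))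
  have hh2 : cylInt 0 (3 * L) (fun p => ‖h p‖ ^ 2) ≤ (δ * M) ^ 2 :=
    (sqrt_le_left (by positivity)).1 hhM
  have hf2 : cylInt 0 (3 * L) (fun p => ‖aa p + bb p‖ ^ 2) ≤ 16 * δ ^ 2 * M ^ 2 := by
    have hle := cylInt_mono hT (f := fun p => ‖aa p + bb p‖ ^ 2)
      (g := fun p => 4 * ‖h p‖ ^ 2 + 4 * δ ^ 2 * e p) (by fun_prop) (by fun_prop)
      fun t ht θ => by
        refine (pow_le_pow_left₀ (norm_nonneg _) (hf t ht θ) 2).trans ?_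
        simp only [he]
        generalize ‖h (t, θ)‖ = H
        generalize ‖u (t, θ)‖ = U
        generalize ‖a (t, θ)‖ = A
        generalize ‖b (t, θ)‖ = B
        nlinarith [sq_nonneg (H - δ * U), sq_nonneg (H - δ * A), sq_nonneg (H - δ * B),
          sq_nonneg (δ * U - δ * A), sq_nonneg (δ * U - δ * B), sq_nonneg (δ * A - δ * B)]
    rw [cylInt_add (by fun_prop) (by fun_prop), cylInt_const_mul, cylInt_const_mul, hN] at hle
    nlinarith [sq_nonneg δ]
  have hmid := J.middle_le (by linarith) hδ hδ1 hMpos (by rw [← he, hN]; linarith) hf2 h1 h2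
  rw [← he, hN, ← hN₂] at hmid
  set g := (cosh (9 / 4 * L))⁻¹
  have hg0 : 0 < g := inv_pos.2 (cosh_pos _)
  have k1 : 3 / 4 * g * (N₁ + N₂ + N₃) ≤ 3 / 4 * g * (3 * (exp L * N₂)) := by
    gcongr
    linarith
  have k2 : cylConst L * δ * M ^ 2 ≤ cylConst L * δ * (exp L * N₂) := by gcongr
  nlinarith [mul_lt_mul_of_pos_right hconst hN₂pos]

/-- The closed strip `[0, T] × ℝ`. -/
abbrev cylStrip (T : ℝ) : Set (ℝ × ℝ) := Set.Icc 0 T ×ˢ Set.univ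

/-- The retraction of the plane onto the strip `[0, T] × ℝ`. -/
noncomputable def clampStrip (T : ℝ) (p : ℝ × ℝ) : ℝ × ℝ := (max 0 (min T p.1), p.2)

theorem continuous_clampStrip (T : ℝ) : Continuous (clampStrip T) := by
  unfold clampStrip
  fun_prop

theorem clampStrip_mem {T : ℝ} (hT : 0 ≤ T) (p : ℝ × ℝ) : clampStrip T p ∈ cylStrip T :=
  ⟨⟨le_max_left _ _, max_le hT (min_le_left _ _)⟩, Set.mem_univ _⟩

theorem clampStrip_of_mem {T t : ℝ} (ht : t ∈ Set.Icc 0 T) (θ : ℝ) :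
    clampStrip T (t, θ) = (t, θ) := by
  simp [clampStrip, ht.1, ht.2]

theorem cylStrip_mem_nhds {T t : ℝ} (ht : t ∈ Set.Ioo 0 T) (θ : ℝ) :
    cylStrip T ∈ nhds (t, θ) :=
  prod_mem_nhds (Icc_mem_nhds ht.1 ht.2) Filter.univ_mem

theorem uniqueDiffOn_cylStrip {T : ℝ} (hT : 0 < T) : UniqueDiffOn ℝ (cylStrip T) :=
  (uniqueDiffOn_Icc hT).prod uniqueDiffOn_univ

/-- Directional derivative along `e` within the strip `[0, T] × ℝ`. -/
noncomputable def stripDeriv (T : ℝ) (e : ℝ × ℝ) (v : ℝ × ℝ → E) (p : ℝ × ℝ) : E :=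
  fderivWithin ℝ v (cylStrip T) p e

theorem contDiffOn_stripDeriv {T : ℝ} (hT : 0 < T) {m n : WithTop ℕ∞} {v : ℝ × ℝ → E}
    (hv : ContDiffOn ℝ n v (cylStrip T)) (hmn : m + 1 ≤ n) (e : ℝ × ℝ) :
    ContDiffOn ℝ m (stripDeriv T e v) (cylStrip T) :=
  (hv.fderivWithin (uniqueDiffOn_cylStrip hT) hmn).clm_apply contDiffOn_const

theorem fderiv_apply_eq_stripDeriv {T t : ℝ} (ht : t ∈ Set.Ioo 0 T) (θ : ℝ) (e : ℝ × ℝ)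
    (v : ℝ × ℝ → E) : fderiv ℝ v (t, θ) e = stripDeriv T e v (t, θ) := by
  rw [stripDeriv, fderivWithin_of_mem_nhds (cylStrip_mem_nhds ht θ)]

theorem fderiv_fderiv_apply_eq_stripDeriv {T t : ℝ} (ht : t ∈ Set.Ioo 0 T) (θ : ℝ)
    (e e' : ℝ × ℝ) (v : ℝ × ℝ → E) :
    fderiv ℝ (fun p => fderiv ℝ v p e) (t, θ) e' =
      stripDeriv T e' (stripDeriv T e v) (t, θ) := by
  rw [← fderiv_apply_eq_stripDeriv ht]
  congr 1
  refine Filter.EventuallyEq.fderiv_eq ?_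
  filter_upwards [prod_mem_nhds (Ioo_mem_nhds ht.1 ht.2) (Filter.univ_mem (f := nhds θ))]
    with p hp
  exact fderiv_apply_eq_stripDeriv hp.1 p.2 e v

theorem hasDerivAt_clampStrip_t {T t : ℝ} (ht : t ∈ Set.Ioo 0 T) (θ : ℝ) {v : ℝ × ℝ → E}
    (hv : ContDiffOn ℝ 1 v (cylStrip T)) :
    HasDerivAt (fun t => v (clampStrip T (t, θ)))
      (stripDeriv T (1, 0) v (clampStrip T (t, θ))) t := by
  rw [clampStrip_of_mem (Set.Ioo_subset_Icc_self ht), ← fderiv_apply_eq_stripDeriv ht]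
  have h1 : DifferentiableAt ℝ v (t, θ) :=
    (hv.contDiffAt (cylStrip_mem_nhds ht θ)).differentiableAt one_ne_zero
  have h2 := h1.hasFDerivAt.comp_hasDerivAt t ((hasDerivAt_id t).prodMk (hasDerivAt_const t θ))
  refine h2.congr_of_eventuallyEq ?_
  filter_upwards [Ioo_mem_nhds ht.1 ht.2] with s hs
  simp [clampStrip_of_mem (Set.Ioo_subset_Icc_self hs)]

theorem hasDerivAt_clampStrip_θ {T : ℝ} (hT : 0 ≤ T) (t θ : ℝ) {v : ℝ × ℝ → E}
    (hv : ContDiffOn ℝ 1 v (cylStrip T)) :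
    HasDerivAt (fun θ => v (clampStrip T (t, θ)))
      (stripDeriv T (0, 1) v (clampStrip T (t, θ))) θ := by
  have h1 := ((hv.differentiableOn one_ne_zero) _ (clampStrip_mem hT (t, θ))).hasFDerivWithinAt
  have h2 : HasDerivWithinAt (fun θ => clampStrip T (t, θ)) (0, 1) Set.univ θ :=
    (((hasDerivAt_const θ (max 0 (min T t))).prodMk (hasDerivAt_id θ))).hasDerivWithinAt
  exact hasDerivWithinAt_univ.1
    (h1.comp_hasDerivWithinAt θ h2 fun x _ => clampStrip_mem hT (t, x))

theorem isCylJet_clampStrip {T : ℝ} (hT : 0 < T) {u : ℝ × ℝ → E}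
    (hu : ContDiffOn ℝ 2 u (cylStrip T)) (hper : ∀ t θ : ℝ, u (t, θ + 2 * π) = u (t, θ)) :
    IsCylJet T (fun p => u (clampStrip T p))
      (fun p => stripDeriv T (1, 0) u (clampStrip T p))
      (fun p => stripDeriv T (0, 1) u (clampStrip T p))
      (fun p => stripDeriv T (1, 0) (stripDeriv T (1, 0) u) (clampStrip T p))
      (fun p => stripDeriv T (0, 1) (stripDeriv T (0, 1) u) (clampStrip T p)) := by
  have hu1 (e : ℝ × ℝ) : ContDiffOn ℝ 1 (stripDeriv T e u) (cylStrip T) :=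
    contDiffOn_stripDeriv hT hu (by norm_num) e
  have hu2 (e : ℝ × ℝ) : ContDiffOn ℝ 0 (stripDeriv T e (stripDeriv T e u)) (cylStrip T) :=
    contDiffOn_stripDeriv hT (hu1 e) (by norm_num) e
  have hc {v : ℝ × ℝ → E} (hv : ContinuousOn v (cylStrip T)) :
      Continuous fun p => v (clampStrip T p) :=
    hv.comp_continuous (continuous_clampStrip T) (clampStrip_mem hT.le)
  have hu0 : ContDiffOn ℝ 1 u (cylStrip T) := hu.of_le one_le_two
  exact
    { cont := hc hu.continuousOn
      cont_t := hc (hu1 _).continuousOn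
      cont_θ := hc (hu1 _).continuousOn
      cont_tt := hc (hu2 _).continuousOn
      cont_θθ := hc (hu2 _).continuousOn
      deriv_t := fun t ht θ => hasDerivAt_clampStrip_t ht θ hu0
      deriv_tt := fun t ht θ => hasDerivAt_clampStrip_t ht θ (hu1 _)
      deriv_θ := fun t θ => hasDerivAt_clampStrip_θ hT.le t θ hu0
      deriv_θθ := fun t θ => hasDerivAt_clampStrip_θ hT.le t θ (hu1 _)
      periodic := fun t θ => hper _ _ }

theorem normOneSq_eq_cylInt {L T : ℝ} (hL : 0 ≤ L) {i : ℕ} (hi : 1 ≤ i) (hiT : i * L ≤ T)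
    (u : ℝ × ℝ → E) :
    normOneSq L i u = cylInt (((i : ℝ) - 1) * L) ((i : ℝ) * L) (fun p =>
      ‖u (clampStrip T p)‖ ^ 2 + ‖stripDeriv T (1, 0) u (clampStrip T p)‖ ^ 2 +
        ‖stripDeriv T (0, 1) u (clampStrip T p)‖ ^ 2) := by
  have hi' : (1 : ℝ) ≤ i := by exact_mod_cast hi
  refine intervalIntegral.integral_congr_Ioo_of_le (by nlinarith) fun t ht => ?_
  have ht' : t ∈ Set.Ioo 0 T :=
    ⟨lt_of_le_of_lt (mul_nonneg (by linarith) hL) ht.1, ht.2.trans_le hiT⟩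
  simp only [clampStrip_of_mem (Set.Ioo_subset_Icc_self ht'), pt, pθ,
    fderiv_apply_eq_stripDeriv ht']

/-- There exists `L₁ > 0` such that for every `L ≥ L₁` there is `δ₀ > 0` with: any `2π`-periodic
`C²` solution `u` of `Δu + A_t ∂_t u + A_θ ∂_θ u + B u = h` on `[0,3L] × ℝ`, with coefficients
bounded by `δ₀`, `‖h‖_{L²} ≤ δ₀ · maxᵢ ‖u‖₁,ᵢ`, and whose circle means at `t = L` and `t = 2L`
are bounded by `δ₀ · maxᵢ ‖u‖₁,ᵢ`, satisfies either `‖u‖₁,₂ ≤ e^{-L/2} ‖u‖₁,₁` or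
`‖u‖₁,₂ ≤ e^{-L/2} ‖u‖₁,₃`. -/
theorem perturbed_harmonic_three_annuli_mean_small :
    ∃ L₁ : ℝ, 0 < L₁ ∧ ∀ L : ℝ, L₁ ≤ L → ∃ δ₀ : ℝ, 0 < δ₀ ∧
      ∀ (k : ℕ) (u h : ℝ × ℝ → EuclideanSpace ℝ (Fin k))
        (At Aθ B : ℝ × ℝ → (EuclideanSpace ℝ (Fin k) →L[ℝ] EuclideanSpace ℝ (Fin k))),
        ContDiffOn ℝ 2 u ((Set.Icc (0 : ℝ) (3 * L)) ×ˢ (Set.univ : Set ℝ)) →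
        (∀ t θ : ℝ, u (t, θ + 2 * π) = u (t, θ)) →
        Continuous At → Continuous Aθ → Continuous B → Continuous h →
        (∀ p ∈ (Set.Icc (0 : ℝ) (3 * L)) ×ˢ (Set.univ : Set ℝ), ‖At p‖ ≤ δ₀) →
        (∀ p ∈ (Set.Icc (0 : ℝ) (3 * L)) ×ˢ (Set.univ : Set ℝ), ‖Aθ p‖ ≤ δ₀) →
        (∀ p ∈ (Set.Icc (0 : ℝ) (3 * L)) ×ˢ (Set.univ : Set ℝ), ‖B p‖ ≤ δ₀) →
        (∀ p ∈ (Set.Icc (0 : ℝ) (3 * L)) ×ˢ (Set.univ : Set ℝ),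
          cylLap u p + At p (pt u p) + Aθ p (pθ u p) + B p (u p) = h p) →
        Real.sqrt (∫ t in (0 : ℝ)..(3 * L), ∫ θ in (0 : ℝ)..(2 * π), ‖h (t, θ)‖ ^ 2) ≤
          δ₀ * max (normOne L 1 u) (max (normOne L 2 u) (normOne L 3 u)) →
        ‖∫ θ in (0 : ℝ)..(2 * π), u (L, θ)‖ ≤
          δ₀ * max (normOne L 1 u) (max (normOne L 2 u) (normOne L 3 u)) →
        ‖∫ θ in (0 : ℝ)..(2 * π), u (2 * L, θ)‖ ≤
          δ₀ * max (normOne L 1 u) (max (normOne L 2 u) (normOne L 3 u)) →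
        (normOne L 2 u ≤ Real.exp (-(L / 2)) * normOne L 1 u ∨
         normOne L 2 u ≤ Real.exp (-(L / 2)) * normOne L 3 u) := by
  refine ⟨160, by norm_num, fun L hL => ⟨cylDelta L, cylDelta_pos (by linarith), ?_⟩⟩
  intro k u h At Aθ B hu hper _ _ _ hh hAt hAθ hB heq hhM hm1 hm2
  have hT : 0 < 3 * L := by linarith
  have J := isCylJet_clampStrip hT hu hper
  have e1 := normOneSq_eq_cylInt (T := 3 * L) (by linarith) le_rfl
    (by push_cast; linarith : ((1 : ℕ) : ℝ) * L ≤ 3 * L) u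
  have e2 := normOneSq_eq_cylInt (T := 3 * L) (by linarith) one_le_two
    (by push_cast; linarith : ((2 : ℕ) : ℝ) * L ≤ 3 * L) u
  have e3 := normOneSq_eq_cylInt (T := 3 * L) (by linarith) (by norm_num : 1 ≤ 3)
    (by push_cast; linarith : ((3 : ℕ) : ℝ) * L ≤ 3 * L) u
  norm_num at e1 e2 e3
  refine J.three_annuli hL hh (fun t ht θ => ?_) e1 e2 e3 rfl hhM ?_ ?_
  · have ht' := Set.Ioo_subset_Icc_self ht
    have hp : (t, θ) ∈ Set.Icc (0 : ℝ) (3 * L) ×ˢ (Set.univ : Set ℝ) := ⟨ht', Set.mem_univ _⟩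
    have hlap := heq (t, θ) hp
    rw [cylLap] at hlap
    unfold pt pθ at hlap
    simp only [fderiv_fderiv_apply_eq_stripDeriv ht, fderiv_apply_eq_stripDeriv ht] at hlap
    simp only [clampStrip_of_mem ht']
    have bound {A : EuclideanSpace ℝ (Fin k) →L[ℝ] EuclideanSpace ℝ (Fin k)}
        (hA : ‖A‖ ≤ cylDelta L) (x : EuclideanSpace ℝ (Fin k)) : ‖A x‖ ≤ cylDelta L * ‖x‖ :=
      A.le_of_opNorm_le hA x
    have b1 := bound (hAt _ hp) (stripDeriv (3 * L) (1, 0) u (t, θ))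
    have b2 := bound (hAθ _ hp) (stripDeriv (3 * L) (0, 1) u (t, θ))
    have b3 := bound (hB _ hp) (u (t, θ))
    rw [add_assoc, add_assoc, ← eq_sub_iff_add_eq] at hlap
    rw [hlap]
    refine (norm_sub_le _ _).trans ?_
    have b4 := norm_add₃_le (a := At (t, θ) (stripDeriv (3 * L) (1, 0) u (t, θ)))
      (b := Aθ (t, θ) (stripDeriv (3 * L) (0, 1) u (t, θ))) (c := B (t, θ) (u (t, θ)))
    rw [add_assoc] at b4
    linarith
  · simpa only [normOne, clampStrip_of_mem (⟨by linarith, by linarith⟩ : L ∈ Set.Icc 0 (3 * L))] using hm1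
  · simpa only [normOne, clampStrip_of_mem (⟨by linarith, by linarith⟩ : 2 * L ∈ Set.Icc 0 (3 * L))]
      using hm2
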